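/- Fix n, k ≤ n, and positive degrees d_0, d_1,…,d_k, d_{k+1}. There exists a real polynomial ℛ in the coefficients of tuples (p_0, p_1,…,p_k, q) with p_i ∈ ℝ[x]_{d_i} (i = 0,…,k) and q ∈ ℝ[x]_{d_{k+1}}, where ℛ is not the identically zero polynomial, such that whenever ℛ(p_0,…,p_k; q) ≠ 0, there is no point x ∈ ℂⁿ satisfying simultaneously: the n×(k+1) matrix [∇p_0(x), ∇p_1(x),…,∇p_k(x)] has rank at most k, p_1(x) = ⋯ = p_k(x) = 0, and q(x) = 0. -/

import Mathlib

open MvPolynomial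

noncomputable section

/-- Evaluation of a polynomial `ℛ` in the coefficients of the tuple `(p₀, p, q)`. -/
def evalCoeffs {n k : ℕ}
    (R : MvPolynomial ((Unit ⊕ Fin k ⊕ Unit) × (Fin n →₀ ℕ)) ℝ)
    (p0 : MvPolynomial (Fin n) ℝ) (p : Fin k → MvPolynomial (Fin n) ℝ)
    (q : MvPolynomial (Fin n) ℝ) : ℝ :=
  eval (fun v => coeff v.2 (Sum.elim (fun _ : Unit => p0) (Sum.elim p (fun _ : Unit => q)) v.1)) R

/-- More polynomials than variables are algebraically dependent. -/
theorem exists_ne_zero_aeval_eq_zero_of_card_lt {K ι τ : Type*} [Field K] [Fintype ι] [Fintype τ]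
    (h : Fintype.card τ < Fintype.card ι) (φ : ι → MvPolynomial τ K) :
    ∃ R : MvPolynomial ι K, R ≠ 0 ∧ aeval φ R = 0 := by
  have hφ : ¬ AlgebraicIndependent K φ := fun hφ => by
    have hle := hφ.lift_cardinalMk_le_trdeg
    rw [MvPolynomial.trdeg_of_isDomain] at hle
    simp only [Cardinal.mk_fintype, Cardinal.lift_natCast, Nat.cast_le] at hle
    omega
  rw [algebraicIndependent_iff] at hφ
  push Not at hφ
  obtain ⟨R, h0, hR⟩ := hφ
  exact ⟨R, hR, h0⟩

section Elimination

variable {A B J σ : Type*} [CommRing A] [CommRing B] [DecidableEq J]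

/-- Correct the linear part of `h j₀` so that `∑ j, ν j • ∇ (h j)` vanishes at `x`,
provided `ν j₀ = 1`. -/
def correctGradient [Fintype J] [Fintype σ] (h : J → MvPolynomial σ A) (ν : J → A)
    (x : σ → A) (j₀ : J) : J → MvPolynomial σ A := fun j =>
  h j - if j = j₀ then ∑ i, C (∑ l, ν l * eval x (pderiv i (h l))) * X i else 0

/-- Correct the constant terms of `h j`, `j ∈ V`, so that these polynomials vanish at `x`. -/
def correctValue (h : J → MvPolynomial σ A) (x : σ → A) (V : Finset J) :
    J → MvPolynomial σ A := fun j => h j - if j ∈ V then C (eval x (h j)) else 0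

theorem map_correctGradient [Fintype J] [Fintype σ] (g : A →+* B) (h : J → MvPolynomial σ A)
    (ν : J → A) (x : σ → A) (j₀ j : J) :
    map g (correctGradient h ν x j₀ j) =
      correctGradient (fun j => map g (h j)) (g ∘ ν) (g ∘ x) j₀ j := by
  simp only [correctGradient, map_sub, apply_ite (map g), map_sum, map_mul, map_C, map_X, map_zero,
    Function.comp_apply, pderiv_map]
  congr! 7
  rw [eval_map, eval₂_comp]

theorem map_correctValue (g : A →+* B) (h : J → MvPolynomial σ A) (x : σ → A)
    (V : Finset J) (j : J) :
    map g (correctValue h x V j) = correctValue (fun j => map g (h j)) (g ∘ x) V j := by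
  simp only [correctValue, map_sub, apply_ite (map g), map_C, map_zero]
  congr! 3
  rw [eval_map, eval₂_comp]

/-- A tuple with a prescribed critical point is recovered from its remaining coefficients. -/
theorem correctValue_correctGradient [Fintype J] [Fintype σ] (f : J → MvPolynomial σ A)
    (ν : J → A) (x : σ → A) (j₀ : J) (V : Finset J) (a : σ → A) (b : J → A) (hν : ν j₀ = 1)
    (hgrad : ∀ i, ∑ j, ν j * eval x (pderiv i (f j)) = 0) (hval : ∀ j ∈ V, eval x (f j) = 0) :
    correctValue (correctGradient (fun j => f j - (if j = j₀ then ∑ i, C (a i) * X i else 0) -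
      if j ∈ V then C (b j) else 0) ν x j₀) x V = f := by
  classical
  have hlin : correctGradient (fun j => f j - (if j = j₀ then ∑ i, C (a i) * X i else 0) -
      if j ∈ V then C (b j) else 0) ν x j₀ = fun j => f j - if j ∈ V then C (b j) else 0 := by
    have key : ∀ i, ∑ l, ν l * eval x (pderiv i (f l - (if l = j₀ then ∑ i, C (a i) * X i else 0) -
        if l ∈ V then C (b l) else 0)) = - a i := by
      intro i
      have hl : ∀ l, ν l * eval x (pderiv i (f l - (if l = j₀ then ∑ i, C (a i) * X i else 0) -
          if l ∈ V then C (b l) else 0)) =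
          ν l * eval x (pderiv i (f l)) - if l = j₀ then a i else 0 := by
        intro l
        have hV : pderiv i (if l ∈ V then C (b l) else (0 : MvPolynomial σ A)) = 0 := by
          split_ifs <;> simp
        rw [map_sub, hV]
        split_ifs with h
        · subst h
          simp [hν, pderiv_X, Pi.single_apply]
        · simp
      rw [Finset.sum_congr rfl fun l _ => hl l, Finset.sum_sub_distrib, hgrad i]
      simp
    funext j
    simp only [correctGradient, key]
    split_ifs <;> simp [sub_right_comm]
  rw [hlin]
  funext j
  by_cases hj : j ∈ V <;> simp [correctValue, hj, hval]


variable [Fintype σ]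

/-- The coefficient positions `(j, m)` of tuples of polynomials with degree bounds `D`. -/
def coeffPositions {J : Type*} [Fintype J] (σ : Type*) [Fintype σ] (D : J → ℕ) :
    Finset (J × (σ →₀ ℕ)) :=
  Set.Finite.toFinset (s := {s | s.2.degree ≤ D s.1}) <|
    (Set.finite_univ.prod (Finsupp.finite_of_degree_le (∑ j, D j))).subset fun s hs =>
      ⟨trivial, (show s.2.degree ≤ D s.1 from hs).trans
        (Finset.single_le_sum (fun _ _ => Nat.zero_le _) (Finset.mem_univ s.1))⟩

theorem mem_coeffPositions {J : Type*} [Fintype J] {D : J → ℕ} {s : J × (σ →₀ ℕ)} :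
    s ∈ coeffPositions σ D ↔ s.2.degree ≤ D s.1 := by
  simp [coeffPositions]

open Classical in
/-- The positions of the linear coefficients at `j₀` and of the constant coefficients at `V`. -/
def solvedPositions (σ : Type*) [Fintype σ] (j₀ : J) (V : Finset J) : Finset (J × (σ →₀ ℕ)) :=
  (Finset.univ.image fun i : σ => (j₀, Finsupp.single i 1)) ∪ V.image fun j => (j, 0)

theorem mem_solvedPositions {j₀ : J} {V : Finset J} {s : J × (σ →₀ ℕ)} :
    s ∈ solvedPositions σ j₀ V ↔ (s.1 = j₀ ∧ ∃ i, s.2 = Finsupp.single i 1) ∨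
      (s.1 ∈ V ∧ s.2 = 0) := by
  obtain ⟨j, m⟩ := s
  simp only [solvedPositions, Finset.mem_union, Finset.mem_image, Finset.mem_univ, true_and,
    Prod.mk.injEq]
  grind

theorem card_solvedPositions (j₀ : J) (V : Finset J) :
    (solvedPositions σ j₀ V).card = Fintype.card σ + V.card := by
  classical
  rw [solvedPositions, Finset.card_union_of_disjoint, Finset.card_image_of_injective,
    Finset.card_image_of_injective, Finset.card_univ]
  · exact Prod.mk_left_injective _
  · intro i i' h
    simpa [Finsupp.single_left_inj] using h
  · rw [Finset.disjoint_left]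
    rintro s hs ht
    obtain ⟨i, -, rfl⟩ := Finset.mem_image.1 hs
    obtain ⟨j, -, hj⟩ := Finset.mem_image.1 ht
    simpa using (congrArg Prod.snd hj).symm

theorem solvedPositions_subset [Fintype J] {D : J → ℕ} (hD : ∀ j, 0 < D j) (j₀ : J) (V : Finset J) :
    solvedPositions σ j₀ V ⊆ coeffPositions σ D := by
  rintro ⟨j, m⟩ hs
  rw [mem_coeffPositions]
  obtain ⟨-, i, rfl : m = _⟩ | ⟨-, rfl : m = _⟩ := mem_solvedPositions.1 hs
  · simpa using Nat.succ_le_of_lt (hD j)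
  · simp

open Classical in
/-- A polynomial of bounded degree splits into its solved coefficients and the remaining ones. -/
theorem sum_monomial_sdiff_solvedPositions [Fintype J] {D : J → ℕ} (j₀ : J)
    (V : Finset J) (f : J → MvPolynomial σ A) (hf : ∀ j, (f j).totalDegree ≤ D j) (j : J) :
    ∑ s ∈ coeffPositions σ D \ solvedPositions σ j₀ V,
        (if s.1 = j then monomial s.2 (coeff s.2 (f s.1)) else 0) =
      f j - (if j = j₀ then ∑ i, C (coeff (Finsupp.single i 1) (f j₀)) * X i else 0) -
        if j ∈ V then C (coeff 0 (f j)) else 0 := by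
  ext m
  have hl : coeff m (∑ s ∈ coeffPositions σ D \ solvedPositions σ j₀ V,
        (if s.1 = j then monomial s.2 (coeff s.2 (f s.1)) else 0)) =
      if (j, m) ∈ coeffPositions σ D \ solvedPositions σ j₀ V then coeff m (f j) else 0 := by
    rw [coeff_sum, ← Finset.sum_ite_eq' _ (j, m) fun s => coeff s.2 (f s.1)]
    refine Finset.sum_congr rfl fun s _ => ?_
    obtain ⟨l, m'⟩ := s
    by_cases h : l = j <;> simp [h, coeff_monomial]
  have hr : ∀ i, coeff m (C (coeff (Finsupp.single i 1) (f j₀)) * X i) =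
      if m = Finsupp.single i 1 then coeff m (f j₀) else 0 := by
    intro i
    rw [coeff_C_mul, coeff_X]
    by_cases h : m = Finsupp.single i 1
    · simp [h]
    · simp [h, Ne.symm h]
  rw [hl, coeff_sub, coeff_sub, apply_ite (coeff m), apply_ite (coeff m), coeff_sum, coeff_zero,
    Finset.sum_congr rfl fun i _ => hr i, coeff_C]
  by_cases hE : (j, m) ∈ solvedPositions σ j₀ V
  · rw [if_neg (by simp [hE])]
    obtain ⟨rfl : j = j₀, i, rfl : m = _⟩ | ⟨hj : j ∈ V, rfl : m = 0⟩ := mem_solvedPositions.1 hE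
    · have h0 : ¬ (0 = Finsupp.single i 1) := fun h => by simpa using h.symm
      simp [h0, Finsupp.single_left_inj]
    · have h0 : ∀ i : σ, ¬ (0 = Finsupp.single i 1) := fun i h => by simpa using h.symm
      simp [hj, h0]
  · have h1 : (if j = j₀ then ∑ i, if m = Finsupp.single i 1 then coeff m (f j₀) else 0 else 0)
        = 0 := by
      split_ifs with h
      · refine Finset.sum_eq_zero fun i _ => if_neg fun hm => hE ?_
        exact mem_solvedPositions.2 (Or.inl ⟨h, i, hm⟩)
      · rfl
    have h2 : (if j ∈ V then if 0 = m then coeff 0 (f j) else 0 else 0) = 0 := by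
      split_ifs with h h'
      · exact absurd (mem_solvedPositions.2 (Or.inr ⟨h, h'.symm⟩)) hE
      · rfl
      · rfl
    rw [h1, h2, sub_zero, sub_zero]
    split_ifs with h
    · rfl
    · refine (coeff_eq_zero_of_totalDegree_lt ((hf j).trans_lt ?_)).symm
      have : ¬ m.degree ≤ D j := fun h' =>
        h (Finset.mem_sdiff.2 ⟨mem_coeffPositions.2 h', hE⟩)
      rwa [Finsupp.degree_apply, not_le] at this

/-- A tuple of polynomials of bounded degree which has a common zero `x` of the `f j`, `j ∈ V`,
together with a gradient relation at `x` supported on `L` and normalized at `j₀`, satisfies a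
nontrivial algebraic relation among its coefficients, as soon as `#L ≤ #V`. -/
theorem exists_coeff_relation [Fintype J] (K B : Type*) [Field K] [CommRing B] [Algebra K B]
    {D : J → ℕ} (hD : ∀ j, 0 < D j) {L V : Finset J} {j₀ : J} (hj₀ : j₀ ∈ L)
    (hLV : L.card ≤ V.card) :
    ∃ R : MvPolynomial (coeffPositions σ D) K, R ≠ 0 ∧
      ∀ (f : J → MvPolynomial σ B) (x : σ → B) (ν : J → B), (∀ j, (f j).totalDegree ≤ D j) →
        ν j₀ = 1 → (∀ j ∉ L, ν j = 0) →
        (∀ i, ∑ j, ν j * eval x (pderiv i (f j)) = 0) → (∀ j ∈ V, eval x (f j) = 0) →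
        aeval (fun s : coeffPositions σ D => coeff s.1.2 (f s.1.1)) R = 0 := by
  classical
  let F := coeffPositions σ D \ solvedPositions σ j₀ V
  let τ := F ⊕ σ ⊕ L.erase j₀
  let h : J → MvPolynomial σ (MvPolynomial τ K) := fun j =>
    ∑ s : F, if s.1.1 = j then monomial s.1.2 (X (Sum.inl s)) else 0
  let ν' : J → MvPolynomial τ K := fun j =>
    if j = j₀ then 1 else if hj : j ∈ L.erase j₀ then X (Sum.inr (Sum.inr ⟨j, hj⟩)) else 0
  let x' : σ → MvPolynomial τ K := fun i => X (Sum.inr (Sum.inl i))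
  have hcard : Fintype.card τ < Fintype.card (coeffPositions σ D) := by
    have h1 := Finset.card_sdiff_add_card_eq_card (solvedPositions_subset (σ := σ) hD j₀ V)
    have h2 := Finset.card_erase_add_one hj₀
    rw [card_solvedPositions] at h1
    simp only [τ, F, Fintype.card_sum, Fintype.card_coe]
    omega
  obtain ⟨R, hR, hR0⟩ := exists_ne_zero_aeval_eq_zero_of_card_lt (K := K) hcard fun s =>
    coeff s.1.2 (correctValue (correctGradient h ν' x' j₀) x' V s.1.1)
  refine ⟨R, hR, fun f x ν hf hν hνL hgrad hval => ?_⟩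
  let g : MvPolynomial τ K →ₐ[K] B := aeval (Sum.elim (fun s => coeff s.1.2 (f s.1.1))
    (Sum.elim x fun j => ν j.1))
  have hx : (g : MvPolynomial τ K →+* B) ∘ x' = x := by
    funext i
    simp [g, x']
  have hν' : (g : MvPolynomial τ K →+* B) ∘ ν' = ν := by
    funext j
    by_cases hj : j = j₀
    · simp [ν', hj, hν]
    · by_cases hjL : j ∈ L
      · simp [ν', hj, hjL, g]
      · simp [ν', hj, hjL, hνL]
  have hh : ∀ j, map (g : MvPolynomial τ K →+* B) (h j) =
      f j - (if j = j₀ then ∑ i, C (coeff (Finsupp.single i 1) (f j₀)) * X i else 0) -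
        if j ∈ V then C (coeff 0 (f j)) else 0 := by
    intro j
    rw [← sum_monomial_sdiff_solvedPositions j₀ V f hf j, ← Finset.sum_coe_sort]
    simp only [h, map_sum, apply_ite (map (g : MvPolynomial τ K →+* B)), map_monomial, map_zero]
    simp [g, F]
  have hφ : ∀ s : coeffPositions σ D,
      g (coeff s.1.2 (correctValue (correctGradient h ν' x' j₀) x' V s.1.1)) =
        coeff s.1.2 (f s.1.1) := by
    intro s
    rw [← AlgHom.coe_toRingHom, ← coeff_map, map_correctValue, hx]
    simp only [map_correctGradient, hx, hν', hh]
    rw [correctValue_correctGradient f ν x j₀ V _ (fun j => coeff 0 (f j)) hν hgrad hval]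
  have := congrArg g hR0
  rw [map_zero, ← AlgHom.comp_apply, comp_aeval] at this
  simpa only [hφ] using this

end Elimination

/-- A matrix whose rank is less than its number of columns has a nonzero kernel vector. -/
theorem Matrix.exists_mulVec_eq_zero_of_rank_lt {K m n : Type*} [Field K] [Fintype n]
    {M : Matrix m n K} (h : M.rank < Fintype.card n) :
    ∃ v ≠ 0, M.mulVec v = 0 := by
  have hker : M.mulVecLin.ker ≠ ⊥ := fun hker => by
    have := LinearMap.finrank_range_of_inj (LinearMap.ker_eq_bot.1 hker)
    rw [Module.finrank_fintype_fun_eq_card] at this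
    exact h.ne this
  obtain ⟨v, hv, hv0⟩ := Submodule.exists_mem_ne_zero_of_ne_bot hker
  exact ⟨v, hv0, hv⟩


/-- There is a nonzero polynomial `ℛ` in the coefficients of `(p₀, p₁, …, p_k, q)`
(with the given degree bounds) such that whenever `ℛ(p₀,…,p_k; q) ≠ 0`, there is
no `x ∈ ℂⁿ` at which the matrix of gradients `[∇p₀(x) ∇p₁(x) ⋯ ∇p_k(x)]` has
rank at most `k`, `p₁(x) = ⋯ = p_k(x) = 0`, and `q(x) = 0`. -/
theorem generic_kkt_avoids_hypersurface
    (n k : ℕ) (hk : k ≤ n)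
    (d0 : ℕ) (d : Fin k → ℕ) (dq : ℕ)
    (hd0 : 0 < d0) (hd : ∀ i, 0 < d i) (hdq : 0 < dq) :
    ∃ R : MvPolynomial ((Unit ⊕ Fin k ⊕ Unit) × (Fin n →₀ ℕ)) ℝ,
      (∃ (p0 : MvPolynomial (Fin n) ℝ) (p : Fin k → MvPolynomial (Fin n) ℝ)
          (q : MvPolynomial (Fin n) ℝ),
        p0.totalDegree ≤ d0 ∧ (∀ i, (p i).totalDegree ≤ d i) ∧ q.totalDegree ≤ dq ∧
        evalCoeffs R p0 p q ≠ 0) ∧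
      ∀ (p0 : MvPolynomial (Fin n) ℝ) (p : Fin k → MvPolynomial (Fin n) ℝ)
          (q : MvPolynomial (Fin n) ℝ),
        p0.totalDegree ≤ d0 → (∀ i, (p i).totalDegree ≤ d i) → q.totalDegree ≤ dq →
        evalCoeffs R p0 p q ≠ 0 →
        ¬ ∃ x : Fin n → ℂ,
          (Matrix.of fun (i : Fin n) (j : Unit ⊕ Fin k) =>
              aeval x (pderiv i (Sum.elim (fun _ : Unit => p0) p j))).rank ≤ k ∧
          (∀ i, aeval x (p i) = 0) ∧ aeval x q = 0 := by
  classical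
  let D : Unit ⊕ Fin k ⊕ Unit → ℕ := Sum.elim (fun _ => d0) (Sum.elim d fun _ => dq)
  have hD : ∀ j, 0 < D j := by rintro (_ | i | _) <;> simp [D, hd0, hd, hdq]
  let e : Unit ⊕ Fin k ↪ Unit ⊕ Fin k ⊕ Unit := ⟨Sum.map id Sum.inl,
    Function.injective_id.sumMap Sum.inl_injective⟩
  let L : Finset (Unit ⊕ Fin k ⊕ Unit) := Finset.univ.map e
  let V : Finset (Unit ⊕ Fin k ⊕ Unit) := Finset.univ.map Function.Embedding.inr
  have hLV : L.card ≤ V.card := by simp [L, V, add_comm]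
  choose R hR0 hR using fun j : Unit ⊕ Fin k => exists_coeff_relation (σ := Fin n) ℝ ℂ hD
    (Finset.mem_map_of_mem e (Finset.mem_univ j)) hLV
  refine ⟨rename Subtype.val (∏ j, R j), ?_, ?_⟩
  · obtain ⟨a, ha⟩ : ∃ a, eval a (∏ j, R j) ≠ 0 := by
      by_contra! h
      exact Finset.prod_ne_zero_iff.2 (fun j _ => hR0 j) (funext fun a => by rw [h, map_zero])
    let f : Unit ⊕ Fin k ⊕ Unit → MvPolynomial (Fin n) ℝ := fun j =>
      ∑ s : coeffPositions (Fin n) D, if s.1.1 = j then monomial s.1.2 (a s) else 0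
    have hf : ∀ j, (f j).totalDegree ≤ D j := by
      intro j
      refine totalDegree_finsetSum_le fun s _ => ?_
      split_ifs with h
      · refine (totalDegree_monomial_le _ _).trans ?_
        subst h
        exact mem_coeffPositions.1 s.2
      · simp
    have hcoeff : ∀ s : coeffPositions (Fin n) D, coeff s.1.2 (f s.1.1) = a s := by
      intro s
      rw [coeff_sum, Finset.sum_eq_single s]
      · simp
      · intro t _ hts
        split_ifs with h
        · rw [coeff_monomial, if_neg fun h' => hts (Subtype.ext (Prod.ext h h'))]
        · simp
      · simp
    refine ⟨f (Sum.inl ()), fun i => f (Sum.inr (Sum.inl i)), f (Sum.inr (Sum.inr ())),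
      hf _, fun i => hf _, hf _, ?_⟩
    rw [evalCoeffs, eval_rename]
    convert ha using 2
    congr 1
    funext s
    rw [← hcoeff s]
    obtain ⟨⟨_ | i | _, m⟩, hs⟩ := s <;> rfl
  · rintro p0 p q hp0 hp hq hne ⟨x, hrank, hpx, hqx⟩
    obtain ⟨v, hv0, hv⟩ := Matrix.exists_mulVec_eq_zero_of_rank_lt
      (hrank.trans_lt (by simp [add_comm]))
    obtain ⟨j₀, hj₀⟩ := Function.ne_iff.1 hv0
    let f : Unit ⊕ Fin k ⊕ Unit → MvPolynomial (Fin n) ℝ :=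
      Sum.elim (fun _ => p0) (Sum.elim p fun _ => q)
    let ν : Unit ⊕ Fin k ⊕ Unit → ℂ := Sum.elim (fun u => (v j₀)⁻¹ * v (Sum.inl u))
      (Sum.elim (fun i => (v j₀)⁻¹ * v (Sum.inr i)) 0)
    have hνe : ∀ j, ν (e j) = (v j₀)⁻¹ * v j := by rintro (_ | i) <;> rfl
    have heval : ∀ p : MvPolynomial (Fin n) ℝ,
        eval x (map (algebraMap ℝ ℂ) p) = aeval x p := fun p => by
      rw [eval_map, aeval_def]
    have key := hR j₀ (fun j => map (algebraMap ℝ ℂ) (f j)) x ν ?_ ?_ ?_ ?_ ?_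
    · refine hne ?_
      rw [evalCoeffs, eval_rename, map_prod]
      refine Finset.prod_eq_zero (Finset.mem_univ j₀) ?_
      simp only [coeff_map] at key
      rw [aeval_def, ← Function.comp_def (algebraMap ℝ ℂ), ← eval₂_comp] at key
      exact (algebraMap ℝ ℂ).injective (key.trans (map_zero _).symm)
    · intro j
      refine (Finset.sup_mono (support_map_subset _ _)).trans ?_
      rcases j with _ | i | _
      exacts [hp0, hp i, hq]
    · rw [hνe, inv_mul_cancel₀ hj₀]
    · rintro (_ | i | _) hj
      · exact absurd (Finset.mem_map_of_mem e (Finset.mem_univ (Sum.inl ()))) hj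
      · exact absurd (Finset.mem_map_of_mem e (Finset.mem_univ (Sum.inr i))) hj
      · rfl
    · intro i
      have hvi := congrFun hv i
      simp only [Matrix.mulVec, dotProduct, Matrix.of_apply, Fintype.sum_sum_type, Sum.elim_inl,
        Sum.elim_inr, Pi.zero_apply] at hvi
      simp only [pderiv_map, heval, Fintype.sum_sum_type, ν, f, Sum.elim_inl, Sum.elim_inr,
        Pi.zero_apply, zero_mul, Finset.sum_const_zero, add_zero, mul_assoc, ← Finset.mul_sum,
        ← mul_add]
      simp only [mul_comm (v _)]
      rw [hvi, mul_zero]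
    · intro j hj
      rw [heval]
      rcases j with _ | i | _
      · simp [V] at hj
      · exact hpx i
      · exact hqx
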